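/- There exist fourteen 6-element subsets T₁, …, T₁₄ of ℤ/13ℤ, pairwise inequivalent mod 13, such that every 6-element subset of ℤ/13ℤ containing 0, 1, and 2 is equivalent mod 13 to exactly one of T₁, …, T₁₄. (That is, the 120 six-element subsets of ℤ/13ℤ containing {0, 1, 2} fall into exactly 14 equivalence classes.) -/

import Mathlib

/-- Two finite subsets of `ℤ/mℤ` are equivalent mod `m` if a coloring automorphism
`x ↦ λx + μ` (with `λ` a unit) maps one onto the other. -/
def EquivColorSets (m : ℕ) (S₁ S₂ : Finset (ZMod m)) : Prop :=
  ∃ (l : (ZMod m)ˣ) (μ : ZMod m), S₁.image (fun x => (l : ZMod m) * x + μ) = S₂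

theorem equivColorSets_iff_of_card_eq {S T : Finset (ZMod 13)} (h : S.card = T.card) :
    EquivColorSets 13 S T ↔
      ∃ l : ZMod 13, l ≠ 0 ∧ ∃ μ : ZMod 13, ∀ x ∈ S, l * x + μ ∈ T := by
  have : Fact (Nat.Prime 13) := ⟨by norm_num⟩
  constructor
  · rintro ⟨l, μ, rfl⟩
    exact ⟨l, l.ne_zero, μ, fun x hx => Finset.mem_image_of_mem _ hx⟩
  · rintro ⟨l, hl, μ, hST⟩
    refine ⟨Units.mk0 l hl, μ, Finset.eq_of_subset_of_card_le
      (Finset.image_subset_iff.2 hST) ?_⟩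
    rw [Finset.card_image_of_injective, h]
    intro x y hxy
    simpa [hl] using hxy

theorem EquivColorSets.symm {m : ℕ} {S T : Finset (ZMod m)} (h : EquivColorSets m S T) :
    EquivColorSets m T S := by
  obtain ⟨l, μ, rfl⟩ := h
  refine ⟨l⁻¹, -((l⁻¹ : (ZMod m)ˣ) * μ), ?_⟩
  simp [Finset.image_image, Function.comp_def, mul_add]

theorem EquivColorSets.trans {m : ℕ} {S T U : Finset (ZMod m)} (h : EquivColorSets m S T)
    (h' : EquivColorSets m T U) : EquivColorSets m S U := by
  obtain ⟨l, μ, rfl⟩ := h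
  obtain ⟨l', μ', rfl⟩ := h'
  refine ⟨l' * l, l' * μ + μ', ?_⟩
  rw [Finset.image_image]
  congr 1
  ext x
  simp [mul_add, mul_assoc, add_assoc]

/-- The subset of `ℤ/13ℤ` whose indicator function is given by the binary digits of `k`. -/
def bitSet (k : ℕ) : Finset (ZMod 13) :=
  Finset.univ.filter fun x => k.testBit x.val

/-- Whether some `x ↦ l * x + μ` with `l` nonzero mod 13 maps the residues in `L` into
`bitSet k`. -/
def affineMapsInto (L : List ℕ) (k : ℕ) : Bool :=
  (List.range' 1 12).any fun l => (List.range 13).any fun μ =>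
    L.all fun a => k.testBit ((l * a + μ) % 13)

theorem affineMapsInto_iff {L : List ℕ} {S : Finset (ZMod 13)}
    (hL : ∀ a, a ∈ L ↔ a < 13 ∧ (a : ZMod 13) ∈ S) (k : ℕ) :
    affineMapsInto L k = true ↔
      ∃ l : ZMod 13, l ≠ 0 ∧ ∃ μ : ZMod 13, ∀ x ∈ S, l * x + μ ∈ bitSet k := by
  simp only [affineMapsInto, List.any_eq_true, List.all_eq_true, List.mem_range'_1,
    List.mem_range, bitSet, Finset.mem_filter, Finset.mem_univ, true_and]
  constructor
  · rintro ⟨l, hl, μ, -, h⟩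
    refine ⟨l, ?_, μ, fun x hx => ?_⟩
    · rw [Ne, ZMod.natCast_eq_zero_iff]
      omega
    · have hx' := h x.val ((hL _).2 ⟨x.val_lt, by rwa [ZMod.natCast_zmod_val]⟩)
      rwa [← ZMod.val_natCast, Nat.cast_add, Nat.cast_mul, ZMod.natCast_zmod_val] at hx'
  · rintro ⟨l, hl, μ, h⟩
    have hl' : l.val ≠ 0 := by rwa [Ne, ZMod.val_eq_zero]
    have hl'' := l.val_lt
    refine ⟨l.val, by omega, μ.val, μ.val_lt, fun a ha => ?_⟩
    rw [← ZMod.val_natCast, Nat.cast_add, Nat.cast_mul, ZMod.natCast_zmod_val,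
      ZMod.natCast_zmod_val]
    exact h _ ((hL a).1 ha).2

/-- Binary codes of representatives of the classes of 6-element sets containing `{0, 1, 2}`. -/
def representativeCode : Fin 14 → ℕ :=
  ![287, 303, 95, 159, 559, 175, 335, 111, 183, 63, 2095, 655, 311, 1103]

theorem card_bitSet_representativeCode (i : Fin 14) :
    (bitSet (representativeCode i)).card = 6 := by
  revert i
  decide +kernel

theorem affineMapsInto_representativeCode_eq_false : ∀ i j, i ≠ j →
    affineMapsInto ((List.range 13).filter (representativeCode i).testBit)
      (representativeCode j) = false := by
  decide +kernel

theorem not_equivColorSets_representativeCode {i j : Fin 14} (hij : i ≠ j) :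
    ¬ EquivColorSets 13 (bitSet (representativeCode i)) (bitSet (representativeCode j)) := by
  rw [equivColorSets_iff_of_card_eq (by simp only [card_bitSet_representativeCode]),
    ← affineMapsInto_iff (L := (List.range 13).filter (representativeCode i).testBit),
    affineMapsInto_representativeCode_eq_false i j hij]
  · simp
  · intro a
    simp only [List.mem_filter, List.mem_range, bitSet, Finset.mem_filter, Finset.mem_univ,
      true_and]
    refine and_congr_right fun ha => ?_
    rw [ZMod.val_cast_of_lt ha]

theorem exists_affineMapsInto_representativeCode :
    ∀ L ∈ (List.range' 3 10).sublistsLen 3,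
      ∃ i, affineMapsInto ([0, 1, 2] ++ L) (representativeCode i) = true := by
  decide +kernel

theorem card_eq_length_filter_range (S : Finset (ZMod 13)) :
    ((List.range 13).filter fun a : ℕ => (a : ZMod 13) ∈ S).length = S.card := by
  rw [← List.toFinset_card_of_nodup (List.nodup_range.filter _)]
  refine Finset.card_bij' (fun a _ => (a : ZMod 13)) (fun x _ => x.val) ?_ ?_ ?_ ?_
  · simp
  · intro x hx
    simpa [hx] using x.val_lt
  · intro a ha
    exact ZMod.val_cast_of_lt (by simpa using (List.mem_filter.1 (List.mem_toFinset.1 ha)).1)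
  · simp

theorem exists_equivColorSets_representativeCode {S : Finset (ZMod 13)} (hS : S.card = 6)
    (h : ({0, 1, 2} : Finset (ZMod 13)) ⊆ S) :
    ∃ i, EquivColorSets 13 S (bitSet (representativeCode i)) := by
  set L := (List.range' 3 10).filter fun a : ℕ => (a : ZMod 13) ∈ S with hL
  have h0 : (0 : ZMod 13) ∈ S := h (by simp)
  have h1 : (1 : ZMod 13) ∈ S := h (by simp)
  have h2 : (2 : ZMod 13) ∈ S := h (by simp)
  have hfilter : ((List.range 13).filter fun a : ℕ => (a : ZMod 13) ∈ S) = [0, 1, 2] ++ L := by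
    have hrange : List.range 13 = [0, 1, 2] ++ List.range' 3 10 := by decide
    rw [hrange, List.filter_append, hL]
    simp [h0, h1, h2]
  have hlength : L.length = 3 := by
    have := card_eq_length_filter_range S
    rw [hfilter, hS, List.length_append] at this
    simp only [List.length_cons, List.length_nil] at this
    omega
  obtain ⟨i, hi⟩ := exists_affineMapsInto_representativeCode L
    (List.mem_sublistsLen.2 ⟨List.filter_sublist, hlength⟩)
  refine ⟨i, (equivColorSets_iff_of_card_eq (by rw [hS, card_bitSet_representativeCode])).2
    ((affineMapsInto_iff ?_ _).1 hi)⟩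
  intro a
  simp [← hfilter]

/-- The 6-element subsets of `ℤ/13ℤ` containing `{0, 1, 2}` fall into exactly 14
equivalence classes mod 13. -/
theorem stmt_18 :
    ∃ T : Fin 14 → Finset (ZMod 13),
      (∀ i, (T i).card = 6) ∧
      (∀ i j, i ≠ j → ¬ EquivColorSets 13 (T i) (T j)) ∧
      (∀ S : Finset (ZMod 13), S.card = 6 → ({0, 1, 2} : Finset (ZMod 13)) ⊆ S →
        ∃! i : Fin 14, EquivColorSets 13 S (T i)) := by
  refine ⟨fun i => bitSet (representativeCode i), card_bitSet_representativeCode,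
    fun i j => not_equivColorSets_representativeCode, fun S hS h => ?_⟩
  obtain ⟨i, hi⟩ := exists_equivColorSets_representativeCode hS h
  refine ⟨i, hi, fun j hj => ?_⟩
  by_contra hji
  exact not_equivColorSets_representativeCode hji (hj.symm.trans hi)
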